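/- Let k ≥ 2 be an integer, set ε = 1/(500k²) and ω = 4k·log₂(1/ε)/ε, and let n be a positive integer. If a family 𝓕 ⊆ 2^[n] admits at least one (2,k)-colouring, then 𝓕 can be partitioned into pairwise disjoint subfamilies 𝓐₁,…,𝓐_{k-1}, 𝓤₁,…,𝓤_{k-1}, 𝓓₁,…,𝓓_{k-1}, 𝓟₁,…,𝓟_{k-1}, 𝓡₁,…,𝓡_{k-1} such that, writing 𝓐 = ∪ᵢ𝓐ᵢ, 𝓤 = ∪ᵢ𝓤ᵢ, 𝓓 = ∪ᵢ𝓓ᵢ, 𝓟 = ∪ᵢ𝓟ᵢ, 𝓡 = ∪ᵢ𝓡ᵢ, and setting 𝓤_k = 𝓓₀ = ∅: (P1) the number of (2,k)-colourings of 𝓕 is at most 2^(|𝓐|+|𝓤|+|𝓓|+ε|𝓡|)·3^(|𝓟|/2); (P2) each 𝓐ᵢ is an antichain; (P3) 𝓤₁ = 𝓓_{k-1} = ∅, and for every i ∈ {1,…,k-1}, every set belonging to one of 𝓤ᵢ, 𝓤_{i+1}, 𝓓ᵢ, 𝓓_{i-1}, 𝓟ᵢ or 𝓡ᵢ is comparable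 to at most 2ω sets in 𝓐ᵢ; (P4) for every i ∈ {1,…,k-1} and every choice of 𝓑ᵢ from the three families 𝓤ᵢ∪𝓓ᵢ∪𝓟ᵢ, 𝓤ᵢ∪𝓓_{i-1}, and 𝓓ᵢ∪𝓤_{i+1}, the family 𝓐ᵢ∪𝓑ᵢ contains at most 3ω|𝓑ᵢ| comparable pairs; (P5) every subfamily 𝓗 ⊆ 𝓕 contains an antichain 𝓗' ⊆ 𝓗 with |𝓗'| ≥ |𝓗|/(2k-2). -/

import Mathlib

/-- An `(r,k)`-colouring of a family `F` of subsets of `[n]`: an assignment of one of `r`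
colours to each member of `F` such that no `k`-chain in `F` is monochromatic. -/
def IsRKColouring {n r : ℕ} (k : ℕ) (F : Finset (Finset (Fin n)))
    (c : {A // A ∈ F} → Fin r) : Prop :=
  ∀ ch : Fin k → {A // A ∈ F},
    (∀ i j : Fin k, i < j → (ch i : Finset (Fin n)) ⊂ (ch j : Finset (Fin n))) →
    ∃ i j : Fin k, c (ch i) ≠ c (ch j)

/-- The number of `(r,k)`-colourings of the family `F ⊆ 2^[n]`. -/
noncomputable def numColourings (r k n : ℕ) (F : Finset (Finset (Fin n))) : ℕ :=
  Nat.card {c : {A // A ∈ F} → Fin r // IsRKColouring k F c}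

/-- `F` contains no `k`-chain. -/
def kChainFree (k : ℕ) {n : ℕ} (F : Finset (Finset (Fin n))) : Prop :=
  ¬ ∃ ch : Fin k → Finset (Fin n), (∀ i, ch i ∈ F) ∧
      ∀ i j : Fin k, i < j → ch i ⊂ ch j

/-- `m_{k-1}`, the size of the family of all subsets of `[n]` of size between
`⌊(n-k+2)/2⌋` and `⌊(n+k-2)/2⌋`. -/
def mSize (n k : ℕ) : ℕ := ∑ i ∈ Finset.Icc ((n - k + 2) / 2) ((n + k - 2) / 2), n.choose i

/-- `f(r,k;n)`: the maximum number of `(r,k)`-colourings over all families in `2^[n]`. -/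
noncomputable def fMax (r k n : ℕ) : ℕ :=
  Finset.sup Finset.univ (fun F : Finset (Finset (Fin n)) => numColourings r k n F)

/-- The number of comparable pairs in a family. -/
def cpairs {n : ℕ} (F : Finset (Finset (Fin n))) : ℕ :=
  ((F ×ˢ F).filter fun p => p.1 ⊂ p.2).card

/-- The weight `w_k(F)` of a set `F ⊆ [n]`. -/
noncomputable def wk (n k : ℕ) (F : Finset (Fin n)) : ℝ :=
  min ((n.choose F.card : ℝ))⁻¹ ((n.choose ((n - k) / 2) : ℝ))⁻¹

/-- The weight `w_k(𝓕)` of a family `𝓕 ⊆ 2^[n]`. -/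
noncomputable def wkFam (n k : ℕ) (F : Finset (Finset (Fin n))) : ℝ :=
  ∑ A ∈ F, wk n k A

/-- `ColourChain r f c i x` says that `x` is the `r`-last element of an `r`-chain of `i + 1`
elements which all have colour `c` under `f`. -/
def ColourChain {X : Type*} (r : X → X → Prop) (f : X → Fin 2) (c : Fin 2) : ℕ → X → Prop
  | 0, x => f x = c
  | i + 1, x => f x = c ∧ ∃ y, r y x ∧ ColourChain r f c i y

open Classical in
/-- `Robust V r ω i x` says, recursively, that more than `ω` elements `y` of `V` with `r y x`
are robust of order `i - 1`; every element is robust of order `0`. -/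
def Robust {X : Type*} [Fintype X] (V : X → Prop) (r : X → X → Prop) (ω : ℝ) : ℕ → X → Prop
  | 0, _ => True
  | i + 1, x => ω < ((Finset.univ.filter fun y => V y ∧ r y x ∧ Robust V r ω i y).card : ℝ)

open Classical in
/-- The colourings in `C` agree with `ρ` on `R`, and outside `R` no large set avoids a colour
in too many members of `C`. -/
structure IsSpread {X : Type*} [Fintype X] (C : Finset (X → Fin 2)) (R : Finset X)
    (ρ : X → Fin 2) (ε : ℝ) : Prop where
  agree : ∀ f ∈ C, ∀ x ∈ R, f x = ρ x
  spread : ∀ W : Finset X, Disjoint W R → W.Nonempty → ∀ c : Fin 2,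
    ((C.filter fun f => ∀ x ∈ W, f x ≠ c).card : ℝ) ≤ 2 ^ (-(ε * W.card)) * C.card

lemma ColourChain.colour {X : Type*} {r : X → X → Prop} {f : X → Fin 2} {c : Fin 2} {i : ℕ}
    {x : X} (h : ColourChain r f c i x) : f x = c := by
  cases i with
  | zero => exact h
  | succ i => exact h.1

lemma ColourChain.append {X : Type*} {r : X → X → Prop} {f : X → Fin 2} {c : Fin 2} {j : ℕ} :
    ∀ {i : ℕ} {x : X}, ColourChain r f c i x → ColourChain (fun a b => r b a) f c j x →
      ∃ y, ColourChain r f c (i + j) y := by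
  induction j with
  | zero => exact fun {i x} h _ => ⟨x, h⟩
  | succ j ih =>
    rintro i x h ⟨_, y, hxy, hy⟩
    obtain ⟨z, hz⟩ := ih (i := i + 1) (x := y) ⟨hy.colour, x, hxy, h⟩ hy
    exact ⟨z, by rwa [show i + (j + 1) = i + 1 + j by ring]⟩

lemma Robust.of_succ {X : Type*} [Fintype X] {V : X → Prop} {r : X → X → Prop} {ω : ℝ}
    {i : ℕ} : ∀ {x : X}, Robust V r ω (i + 1) x → Robust V r ω i x := by
  induction i with
  | zero => exact fun _ => trivial
  | succ i ih =>
    intro x h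
    refine lt_of_lt_of_le h (Nat.cast_le.2 (Finset.card_le_card fun y hy => ?_))
    simp only [Finset.mem_filter] at hy ⊢
    exact ⟨hy.1, hy.2.1, hy.2.2.1, ih hy.2.2.2⟩

lemma Robust.anti {X : Type*} [Fintype X] {V : X → Prop} {r : X → X → Prop} {ω : ℝ}
    {i j : ℕ} (hij : i ≤ j) {x : X} (h : Robust V r ω j x) : Robust V r ω i x := by
  induction j, hij using Nat.le_induction with
  | base => exact h
  | succ j _ ih => exact ih h.of_succ

open Classical in
/-- In a spread collection of colourings, few colourings in which a robust element `x` has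
colour `c` fail to have a long chain of colour `c` at `x`. -/
lemma card_not_colourChain_le {X : Type*} [Fintype X] {C : Finset (X → Fin 2)} {R : Finset X}
    {ρ : X → Fin 2} {ε ω : ℝ} (hC : IsSpread C R ρ ε) (hε : 0 ≤ ε) (hω : 0 ≤ ω)
    (c : Fin 2) (r : X → X → Prop) (i : ℕ) :
    ∀ x, Robust (fun y => y ∈ R → ρ y = c) r ω i x →
      ((C.filter fun f => f x = c ∧ ¬ ColourChain r f c i x).card : ℝ) ≤
        2 ^ (-(ε * ω)) * (ω + 2) ^ i * C.card := by
  have hp : (0 : ℝ) < 2 ^ (-(ε * ω)) := by positivity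
  induction i with
  | zero =>
    intro x _
    have : (C.filter fun f => f x = c ∧ ¬ ColourChain r f c 0 x) = ∅ := by
      ext f; simp [ColourChain]
    rw [this]
    simp only [Finset.card_empty, Nat.cast_zero]
    positivity
  | succ i ih =>
    intro x hx
    have hx' : ⌊ω⌋₊ + 1 ≤ _ := Nat.succ_le_of_lt ((Nat.floor_lt hω).2 hx)
    obtain ⟨W, hWK, hW⟩ := Finset.exists_subset_card_eq hx'
    have hK : ∀ y ∈ W, (y ∈ R → ρ y = c) ∧ r y x ∧
        Robust (fun y => y ∈ R → ρ y = c) r ω i y := fun y hy => by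
      simpa using hWK hy
    have step : ∀ f : X → Fin 2, ∀ y ∈ W, f x = c → ¬ ColourChain r f c (i + 1) x →
        ¬ ColourChain r f c i y := fun f y hy h1 h2 h3 => h2 ⟨h1, y, (hK y hy).2.1, h3⟩
    have hpow : (1 : ℝ) ≤ (ω + 2) ^ i := one_le_pow₀ (by linarith)
    by_cases hWR : Disjoint W R
    · have hsub : (C.filter fun f => f x = c ∧ ¬ ColourChain r f c (i + 1) x) ⊆
          (C.filter fun f => ∀ y ∈ W, f y ≠ c) ∪
            W.biUnion fun y => C.filter fun f => f y = c ∧ ¬ ColourChain r f c i y := by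
        intro f hf
        simp only [Finset.mem_filter, Finset.mem_union, Finset.mem_biUnion] at hf ⊢
        by_cases h : ∀ y ∈ W, f y ≠ c
        · exact Or.inl ⟨hf.1, h⟩
        · push Not at h
          obtain ⟨y, hy, hfy⟩ := h
          exact Or.inr ⟨y, hy, hf.1, hfy, step f y hy hf.2.1 hf.2.2⟩
      have h1 := (Finset.card_le_card hsub).trans
        ((Finset.card_union_le _ _).trans (Nat.add_le_add_left Finset.card_biUnion_le _))
      have h2 : ((C.filter fun f => ∀ y ∈ W, f y ≠ c).card : ℝ) ≤ 2 ^ (-(ε * ω)) * C.card := by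
        refine (hC.spread W hWR (Finset.card_pos.1 (by omega)) c).trans ?_
        gcongr
        · norm_num
        · rw [hW]; push_cast; exact (Nat.lt_floor_add_one ω).le
      have h3 : ((∑ y ∈ W, (C.filter fun f => f y = c ∧ ¬ ColourChain r f c i y).card : ℕ) : ℝ)
          ≤ (ω + 1) * (2 ^ (-(ε * ω)) * (ω + 2) ^ i * C.card) := by
        push_cast
        refine (Finset.sum_le_card_nsmul W _ _ fun y hy => ih y (hK y hy).2.2).trans ?_
        rw [nsmul_eq_mul, hW]
        gcongr
        push_cast
        linarith [Nat.floor_le hω]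
      have h4 : ((C.filter fun f => f x = c ∧ ¬ ColourChain r f c (i + 1) x).card : ℝ) ≤
          2 ^ (-(ε * ω)) * C.card + (ω + 1) * (2 ^ (-(ε * ω)) * (ω + 2) ^ i * C.card) := by
        refine le_trans (by exact_mod_cast h1) (add_le_add h2 h3)
      have h5 : 2 ^ (-(ε * ω)) * (C.card : ℝ) ≤ 2 ^ (-(ε * ω)) * C.card * (ω + 2) ^ i :=
        le_mul_of_one_le_right (by positivity) hpow
      rw [pow_succ]
      nlinarith [h4, h5]
    · obtain ⟨y, hy, hyR⟩ := Finset.not_disjoint_iff.1 hWR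
      have hsub : (C.filter fun f => f x = c ∧ ¬ ColourChain r f c (i + 1) x) ⊆
          C.filter fun f => f y = c ∧ ¬ ColourChain r f c i y := by
        intro f hf
        simp only [Finset.mem_filter] at hf ⊢
        exact ⟨hf.1, (hC.agree f hf.1 y hyR).trans ((hK y hy).1 hyR),
          step f y hy hf.2.1 hf.2.2⟩
      refine (Nat.cast_le.2 (Finset.card_le_card hsub)).trans ((ih y (hK y hy).2.2).trans ?_)
      gcongr
      · linarith
      · omega

lemma eq_one_sub_iff_ne : ∀ a b : Fin 2, a = 1 - b ↔ a ≠ b := by decide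

open Classical in
/-- Any nonempty collection of colourings has a spread subcollection obtained by prescribing
the colours on a set `R`, at the cost of a factor at most `2 ^ (ε |R|)`. -/
lemma exists_isSpread {X : Type*} [Fintype X] (C : Finset (X → Fin 2)) (hC : C.Nonempty)
    (ε : ℝ) :
    ∃ C₀ ⊆ C, C₀.Nonempty ∧ ∃ R ρ, IsSpread C₀ R ρ ε ∧
      (C.card : ℝ) ≤ 2 ^ (ε * R.card) * C₀.card := by
  obtain ⟨R, ρ, hR, hmax⟩ : ∃ R : Finset X, ∃ ρ : X → Fin 2,
      (C.card : ℝ) ≤ 2 ^ (ε * R.card) * (C.filter fun f => ∀ x ∈ R, f x = ρ x).card ∧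
      ∀ (R' : Finset X) (ρ' : X → Fin 2),
        (C.card : ℝ) ≤ 2 ^ (ε * R'.card) * (C.filter fun f => ∀ x ∈ R', f x = ρ' x).card →
        R'.card ≤ R.card := by
    have hfin : {s : Finset X × (X → Fin 2) | (C.card : ℝ) ≤
        2 ^ (ε * s.1.card) * (C.filter fun f => ∀ x ∈ s.1, f x = s.2 x).card}.Finite :=
      Set.toFinite _
    obtain ⟨s, hs, hmax⟩ := Set.exists_max_image _ (fun s => s.1.card) hfin
      ⟨(∅, fun _ => 0), by simp⟩
    exact ⟨s.1, s.2, hs, fun R' ρ' h => hmax (R', ρ') h⟩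
  refine ⟨C.filter fun f => ∀ x ∈ R, f x = ρ x, Finset.filter_subset _ _, ?_, R, ρ,
    ⟨?_, ?_⟩, hR⟩
  · rw [← Finset.card_pos, Nat.pos_iff_ne_zero]
    intro h
    have hpos : (0 : ℝ) < C.card := by exact_mod_cast hC.card_pos
    rw [h, Nat.cast_zero, mul_zero] at hR
    exact hpos.not_ge hR
  · exact fun f hf => (Finset.mem_filter.1 hf).2
  · intro W hWR hW c
    by_contra! hlt
    have hcard := hmax (R ∪ W) (fun x => if x ∈ W then 1 - c else ρ x) ?_
    · rw [Finset.card_union_of_disjoint hWR.symm] at hcard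
      have := hW.card_pos
      omega
    · beta_reduce
      have heq : (C.filter fun f => ∀ x ∈ R ∪ W, f x = if x ∈ W then 1 - c else ρ x) =
          (C.filter fun f => ∀ x ∈ R, f x = ρ x).filter fun f => ∀ x ∈ W, f x ≠ c := by
        ext f
        simp only [Finset.mem_filter, Finset.mem_union, and_assoc, and_congr_right_iff]
        intro _
        constructor
        · intro h
          refine ⟨fun x hx => ?_, fun x hx => ?_⟩
          · simpa [Finset.disjoint_right.1 hWR hx] using h x (Or.inl hx)
          · rw [← eq_one_sub_iff_ne]; simpa [hx] using h x (Or.inr hx)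
        · rintro ⟨h1, h2⟩ x hx
          by_cases hxW : x ∈ W
          · simpa [hxW, eq_one_sub_iff_ne] using h2 x hxW
          · simpa [hxW] using h1 x (hx.resolve_right hxW)
      rw [heq, Finset.card_union_of_disjoint hWR.symm]
      refine hR.trans ?_
      have h0 : (2 : ℝ) ^ (ε * (R.card + W.card : ℕ)) * 2 ^ (-(ε * W.card)) =
          2 ^ (ε * R.card) := by
        rw [← Real.rpow_add two_pos]; congr 1; push_cast; ring
      rw [← h0, mul_assoc]
      gcongr

open Classical in
lemma card_le_of_chains {X : Type*} [Fintype X] [PartialOrder X] {C : Finset (X → Fin 2)}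
    {R : Finset X} {ρ : X → Fin 2} {ε ω : ℝ} {k : ℕ} (hC : IsSpread C R ρ ε) (hε : 0 ≤ ε)
    (hω : 0 ≤ ω) (c : Fin 2) {x y : X} {i j : ℕ} (hi : i ≤ k - 1) (hj : j ≤ k - 1)
    (hx : Robust (fun z => z ∈ R → ρ z = c) (fun a b => a < b) ω i x)
    (hy : Robust (fun z => z ∈ R → ρ z = c) (fun a b => b < a) ω j y)
    (hno : ∀ f ∈ C, ColourChain (fun a b => a < b) f c i x →
      ¬ ColourChain (fun a b => b < a) f c j y) :
    ((C.filter fun f => f x = c ∧ f y = c).card : ℝ) ≤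
      2 * (2 ^ (-(ε * ω)) * (ω + 2) ^ (k - 1)) * C.card := by
  have hsub : (C.filter fun f => f x = c ∧ f y = c) ⊆
      (C.filter fun f => f x = c ∧ ¬ ColourChain (fun a b => a < b) f c i x) ∪
        C.filter fun f => f y = c ∧ ¬ ColourChain (fun a b => b < a) f c j y := by
    intro f hf
    simp only [Finset.mem_filter, Finset.mem_union] at hf ⊢
    have := hno f hf.1
    tauto
  have h1 : (((C.filter fun f => f x = c ∧ f y = c).card : ℕ) : ℝ) ≤ _ :=
    Nat.cast_le.2 ((Finset.card_le_card hsub).trans (Finset.card_union_le _ _))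
  push_cast at h1
  have h2 := card_not_colourChain_le hC hε hω c _ i x hx
  have h3 := card_not_colourChain_le hC hε hω c _ j y hy
  have hp : ∀ i ≤ k - 1, 2 ^ (-(ε * ω)) * (ω + 2) ^ i * (C.card : ℝ) ≤
      2 ^ (-(ε * ω)) * (ω + 2) ^ (k - 1) * C.card := by
    intro i hi
    gcongr
    linarith
  linarith [hp i hi, hp j hj]

open Classical in
/-- If `x` may have colour `c`, it is not robust from below and from above of total order
`k - 1`. -/
lemma robust_add_ne {X : Type*} [Fintype X] [PartialOrder X] {C : Finset (X → Fin 2)}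
    {R : Finset X} {ρ : X → Fin 2} {ε ω : ℝ} {k : ℕ} (hC : IsSpread C R ρ ε) (hε : 0 ≤ ε)
    (hω : 0 ≤ ω) (hne : C.Nonempty)
    (hno : ∀ f ∈ C, ∀ c x, ¬ ColourChain (fun a b => a < b) f c (k - 1) x)
    (hq : 2 * (2 ^ (-(ε * ω)) * (ω + 2) ^ (k - 1)) < 1 - (2 : ℝ) ^ (-ε))
    {c : Fin 2} {x : X} (hxc : x ∈ R → ρ x = c) {i j : ℕ}
    (hx : Robust (fun z => z ∈ R → ρ z = c) (fun a b => a < b) ω i x)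
    (hy : Robust (fun z => z ∈ R → ρ z = c) (fun a b => b < a) ω j x) : i + j ≠ k - 1 := by
  intro hij
  have h1 := card_le_of_chains (k := k) hC hε hω c (by omega) (by omega) hx hy
    fun f hf h2 h3 => by
      obtain ⟨y, hy⟩ := h2.append h3
      exact hno f hf c y (hij ▸ hy)
  simp only [and_self] at h1
  have hpos : (0 : ℝ) < C.card := by exact_mod_cast hne.card_pos
  have h2 : (C.card : ℝ) = (C.filter fun f => f x = c).card +
      (C.filter fun f => f x ≠ c).card := by
    exact_mod_cast (Finset.card_filter_add_card_filter_not (s := C) fun f => f x = c).symm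
  have h3 : ((C.filter fun f => f x ≠ c).card : ℝ) ≤ 2 ^ (-ε) * C.card := by
    by_cases hxR : x ∈ R
    · rw [Finset.filter_false_of_mem]
      · simp only [Finset.card_empty, Nat.cast_zero]; positivity
      · exact fun f hf => not_not.2 ((hC.agree f hf x hxR).trans (hxc hxR))
    · simpa using hC.spread {x} (by simpa using hxR) (by simp) c
  nlinarith

open Classical in
/-- Every element gets an interval `[lo x, hi x]` of levels, with few comparabilities between
elements pinned to a common level. -/
lemma exists_levels {X : Type*} [Fintype X] [PartialOrder X] {C : Finset (X → Fin 2)}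
    {R : Finset X} {ρ : X → Fin 2} {ε ω : ℝ} {k : ℕ} (hk : 2 ≤ k) (hC : IsSpread C R ρ ε)
    (hε : 0 ≤ ε) (hω : 0 ≤ ω) (hne : C.Nonempty)
    (hno : ∀ f ∈ C, ∀ c x, ¬ ColourChain (fun a b => a < b) f c (k - 1) x)
    (hq : 2 * (2 ^ (-(ε * ω)) * (ω + 2) ^ (k - 1)) < 1 - (2 : ℝ) ^ (-ε))
    (hq' : 2 ^ (-(ε * ω)) * (ω + 2) ^ (k - 1) ≤ (1 : ℝ) / 200) :
    ∃ lo hi : X → ℕ, (∀ x, lo x ≤ hi x ∧ hi x ≤ k - 2) ∧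
      (∀ x m, lo x ≤ m → m ≤ hi x →
        ((Finset.univ.filter fun y => y ∉ R ∧ lo y = m ∧ hi y = m ∧ (y < x ∨ x < y)).card : ℝ)
          ≤ 2 * ω) ∧
      (∀ x, ((Finset.univ.filter fun y => y ∉ R ∧ lo y = lo x ∧ y < x).card : ℝ) ≤ ω) ∧
      (∀ x y, x ∉ R → y ∉ R → x < y → lo x = hi x → lo y = hi y → lo x = lo y →
        ((C.filter fun f => f x = f y).card : ℝ) ≤ C.card / 50) := by
  let dR (c : Fin 2) (i : ℕ) (x : X) : Prop :=
    Robust (fun z => z ∈ R → ρ z = c) (fun a b => a < b) ω i x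
  let uR (c : Fin 2) (i : ℕ) (x : X) : Prop :=
    Robust (fun z => z ∈ R → ρ z = c) (fun a b => b < a) ω i x
  let dn (c : Fin 2) (x : X) : ℕ := Nat.findGreatest (fun i => dR c i x) (k - 1)
  let up (c : Fin 2) (x : X) : ℕ := Nat.findGreatest (fun i => uR c i x) (k - 1)
  have hdn : ∀ c x, dR c (dn c x) x := fun c x =>
    Nat.findGreatest_spec (P := fun i => dR c i x) (Nat.zero_le _) trivial
  have hup : ∀ c x, uR c (up c x) x := fun c x =>
    Nat.findGreatest_spec (P := fun i => uR c i x) (Nat.zero_le _) trivial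
  have hdn' : ∀ c x i, i ≤ k - 1 → dR c i x → i ≤ dn c x := fun c x i hi h =>
    Nat.le_findGreatest hi h
  have hup' : ∀ c x i, i ≤ k - 1 → uR c i x → i ≤ up c x := fun c x i hi h =>
    Nat.le_findGreatest hi h
  have hsum : ∀ c x, (x ∈ R → ρ x = c) → dn c x + up c x ≤ k - 2 := by
    intro c x hx
    by_contra! hlt
    have h1 : dn c x ≤ k - 1 := Nat.findGreatest_le _
    exact robust_add_ne hC hε hω hne hno hq hx (hdn c x)
      (Robust.anti (i := k - 1 - dn c x) (by omega) (hup c x)) (by omega)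
  have hbelow : ∀ c x m, (x ∈ R → ρ x = c) → dn c x ≤ m → m ≤ k - 2 →
      ((Finset.univ.filter fun y => (y ∈ R → ρ y = c) ∧ y < x ∧ dR c m y).card : ℝ) ≤ ω := by
    intro c x m hx h1 h2
    by_contra! hlt
    have : m + 1 ≤ dn c x := hdn' c x (m + 1) (by omega) (lt_of_lt_of_eq hlt (by congr!))
    omega
  have habove : ∀ c x m, (x ∈ R → ρ x = c) → up c x ≤ m → m ≤ k - 2 →
      ((Finset.univ.filter fun y => (y ∈ R → ρ y = c) ∧ x < y ∧ uR c m y).card : ℝ) ≤ ω := by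
    intro c x m hx h1 h2
    by_contra! hlt
    have : m + 1 ≤ up c x := hup' c x (m + 1) (by omega) (lt_of_lt_of_eq hlt (by congr!))
    omega
  let lo (x : X) : ℕ := if x ∈ R then dn (ρ x) x else min (dn 0 x) (dn 1 x)
  let hi (x : X) : ℕ := if x ∈ R then k - 2 - up (ρ x) x else max (k - 2 - up 0 x) (k - 2 - up 1 x)
  have hlo : ∀ x, ∃ c, (x ∈ R → ρ x = c) ∧ lo x = dn c x := by
    intro x
    by_cases hx : x ∈ R
    · exact ⟨ρ x, fun _ => rfl, by simp [lo, hx]⟩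
    · rcases min_choice (dn 0 x) (dn 1 x) with h | h
      · exact ⟨0, fun h => absurd h hx, by simp only [lo, hx, if_false, h]⟩
      · exact ⟨1, fun h => absurd h hx, by simp only [lo, hx, if_false, h]⟩
  have hhi : ∀ x, ∃ c, (x ∈ R → ρ x = c) ∧ hi x = k - 2 - up c x := by
    intro x
    by_cases hx : x ∈ R
    · exact ⟨ρ x, fun _ => rfl, by simp [hi, hx]⟩
    · rcases max_choice (k - 2 - up 0 x) (k - 2 - up 1 x) with h | h
      · exact ⟨0, fun h => absurd h hx, by simp only [hi, hx, if_false, h]⟩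
      · exact ⟨1, fun h => absurd h hx, by simp only [hi, hx, if_false, h]⟩
  have hlo' : ∀ x c, x ∉ R → lo x ≤ dn c x := by
    intro x c hx
    simp only [lo, hx, if_false]
    fin_cases c <;> simp
  have hhi' : ∀ x c, x ∉ R → k - 2 - up c x ≤ hi x := by
    intro x c hx
    simp only [hi, hx, if_false]
    fin_cases c
    · exact le_max_left _ _
    · exact le_max_right _ _
  refine ⟨lo, hi, ?_, ?_, ?_, ?_⟩
  · intro x
    obtain ⟨d, hd, hd'⟩ := hhi x
    refine ⟨?_, by omega⟩
    by_cases hx : x ∈ R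
    · have := hsum (ρ x) x fun _ => rfl
      simp only [lo, hi, hx, if_true]
      omega
    · have h1 := hsum 0 x fun h => absurd h hx
      have h2 := hlo' x 0 hx
      have h3 := hhi' x 0 hx
      omega
  · intro x m h1 h2
    obtain ⟨c, hc, hc'⟩ := hlo x
    obtain ⟨d, hd, hd'⟩ := hhi x
    have hsub : (Finset.univ.filter fun y => y ∉ R ∧ lo y = m ∧ hi y = m ∧ (y < x ∨ x < y)) ⊆
        (Finset.univ.filter fun y => (y ∈ R → ρ y = c) ∧ y < x ∧ dR c m y) ∪
          Finset.univ.filter fun y => (y ∈ R → ρ y = d) ∧ x < y ∧ uR d (k - 2 - m) y := by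
      intro y hy
      simp only [Finset.mem_filter, Finset.mem_univ, true_and, Finset.mem_union] at hy ⊢
      obtain ⟨hyR, h3, h4, h5 | h5⟩ := hy
      · exact Or.inl ⟨fun h => absurd h hyR, h5,
          Robust.anti (h3 ▸ hlo' y c hyR) (hdn c y)⟩
      · refine Or.inr ⟨fun h => absurd h hyR, h5, Robust.anti ?_ (hup d y)⟩
        have := hhi' y d hyR
        omega
    have h3 : ((_ : ℕ) : ℝ) ≤ _ :=
      Nat.cast_le.2 ((Finset.card_le_card hsub).trans (Finset.card_union_le _ _))
    push_cast at h3
    have h4 := hbelow c x m hc (by omega) (by omega)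
    have h5 := hsum d x hd
    have h6 := habove d x (k - 2 - m) hd (by omega) (by omega)
    linarith
  · intro x
    obtain ⟨c, hc, hc'⟩ := hlo x
    have h1 := hsum c x hc
    refine le_trans (Nat.cast_le.2 (Finset.card_le_card fun y hy => ?_))
      (hbelow c x (dn c x) hc le_rfl (by omega))
    simp only [Finset.mem_filter, Finset.mem_univ, true_and] at hy ⊢
    refine ⟨fun h => absurd h hy.1, hy.2.2, Robust.anti ?_ (hdn c y)⟩
    rw [← hc', ← hy.2.1]
    exact hlo' y c hy.1
  · intro x y hx hy hxy h1 h2 h3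
    have key : ∀ c, ((C.filter fun f => f x = c ∧ f y = c).card : ℝ) ≤
        2 * (2 ^ (-(ε * ω)) * (ω + 2) ^ (k - 1)) * C.card := by
      intro c
      have h4 := hlo' x c hx
      have h5 := hhi' y c hy
      have h6 := hsum c x fun h => absurd h hx
      have h7 := hsum c y fun h => absurd h hy
      refine card_le_of_chains (i := lo x) (j := k - 2 - lo x) hC hε hω c (by omega) (by omega)
        (Robust.anti h4 (hdn c x)) (Robust.anti (by omega) (hup c y)) fun f hf h8 h9 => ?_
      obtain ⟨z, hz⟩ := ColourChain.append (i := lo x + 1) (x := y) ⟨h9.colour, x, hxy, h8⟩ h9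
      exact hno f hf c z (by rwa [show k - 1 = lo x + 1 + (k - 2 - lo x) by omega])
    have hsub : (C.filter fun f => f x = f y) ⊆ (C.filter fun f => f x = 0 ∧ f y = 0) ∪
        C.filter fun f => f x = 1 ∧ f y = 1 := by
      intro f hf
      simp only [Finset.mem_filter, Finset.mem_union] at hf ⊢
      have : f x = 0 ∨ f x = 1 := by omega
      rw [← hf.2]
      tauto
    have h4 : ((_ : ℕ) : ℝ) ≤ _ :=
      Nat.cast_le.2 ((Finset.card_le_card hsub).trans (Finset.card_union_le _ _))
    push_cast at h4
    have h5 := key 0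
    have h6 := key 1
    have h7 : 2 ^ (-(ε * ω)) * (ω + 2) ^ (k - 1) * (C.card : ℝ) ≤ 1 / 200 * C.card := by gcongr
    linarith

open Classical in
/-- A finite set splits into the vertex set of a matching and a set without related pairs. -/
lemma exists_maximal_matching {X : Type*} (r : X → X → Prop) (hr : ∀ x, ¬ r x x)
    (Q : Finset X) :
    ∃ P ⊆ Q, ∃ M : Finset (X × X),
      (∀ p ∈ M, p.1 ∈ P ∧ p.2 ∈ P ∧ r p.1 p.2) ∧ 2 * M.card ≤ P.card ∧
      (∀ x ∈ P, ∃ p ∈ M, x = p.1 ∨ x = p.2) ∧ ∀ x ∈ Q, ∀ y ∈ Q, x ∉ P → y ∉ P → ¬ r x y := by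
  induction Q using Finset.strongInduction with
  | H Q ih =>
    by_cases h : ∃ x ∈ Q, ∃ y ∈ Q, r x y
    · obtain ⟨x, hx, y, hy, hxy⟩ := h
      have hne : x ≠ y := fun h => hr x (h ▸ hxy)
      obtain ⟨P, hPQ, M, h1, h2, h3, h4⟩ := ih ((Q.erase x).erase y)
        ((Finset.erase_subset _ _).trans_ssubset (Finset.erase_ssubset hx))
      have hxP : x ∉ P := fun h => by simpa using hPQ h
      have hyP : y ∉ P := fun h => by simpa using hPQ h
      refine ⟨insert x (insert y P), ?_, insert (x, y) M, ?_, ?_, ?_, ?_⟩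
      · intro z hz
        simp only [Finset.mem_insert] at hz
        rcases hz with rfl | rfl | hz
        · exact hx
        · exact hy
        · exact Finset.mem_of_mem_erase (Finset.mem_of_mem_erase (hPQ hz))
      · intro p hp
        rcases Finset.mem_insert.1 hp with rfl | hp
        · simp [hxy]
        · have := h1 p hp
          simp [this]
      · have h5 := Finset.card_insert_of_notMem hyP
        have h6 := Finset.card_insert_of_notMem (a := x) (s := insert y P) (by simp [hne, hxP])
        have h7 := Finset.card_insert_le (x, y) M
        omega
      · intro z hz
        simp only [Finset.mem_insert] at hz
        rcases hz with rfl | rfl | hz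
        · exact ⟨(z, y), by simp⟩
        · exact ⟨(x, z), by simp⟩
        · obtain ⟨p, hp, h⟩ := h3 z hz
          exact ⟨p, Finset.mem_insert_of_mem hp, h⟩
      · intro a ha b hb haP hbP
        simp only [Finset.mem_insert, not_or] at haP hbP
        exact h4 a (by simp [*]) b (by simp [*]) haP.2.2 hbP.2.2
    · push Not at h
      exact ⟨∅, by simp, ∅, by simp, by simp, by simp, fun x hx y hy _ _ => h x hx y hy⟩

open Classical in
/-- Colourings that rarely give both elements of a pair in `M` the same colour number at most
`2 ^ |S| * 3 ^ |M|`, when they are determined by the pairs in `M` and the elements of `S`. -/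
lemma card_le_two_pow_mul_three_pow {X : Type*} {C : Finset (X → Fin 2)} {R S : Finset X}
    {ρ : X → Fin 2} (M : Finset (X × X)) (hR : ∀ f ∈ C, ∀ x ∈ R, f x = ρ x)
    (hcover : ∀ x, x ∈ R ∨ x ∈ S ∨ ∃ p ∈ M, x = p.1 ∨ x = p.2)
    (hM : ∀ p ∈ M, ((C.filter fun f => f p.1 = f p.2).card : ℝ) ≤ C.card / 50) :
    (C.card : ℝ) ≤ 2 ^ S.card * 3 ^ M.card := by
  let w : Fin 2 × Fin 2 → ℝ := fun a => if a.1 = a.2 then Real.exp (-1) else 1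
  have hw : ∀ a, 0 ≤ w a := fun a => by
    simp only [w]; split_ifs <;> positivity
  let bad : (X → Fin 2) → ℕ := fun f => (M.filter fun p => f p.1 = f p.2).card
  set μ : ℝ := M.card / 50 with hμ
  have hprod : ∀ f : X → Fin 2, ∏ p ∈ M, w (f p.1, f p.2) = Real.exp (-(bad f : ℝ)) := by
    intro f
    simp only [w, Finset.prod_ite, Finset.prod_const, bad]
    rw [← Real.exp_nat_mul]
    ring_nf
  have hbad : (∑ f ∈ C, (bad f : ℝ)) ≤ μ * C.card := by
    have h1 : ∑ f ∈ C, bad f = ∑ p ∈ M, (C.filter fun f => f p.1 = f p.2).card := by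
      simp only [bad, Finset.card_filter]
      exact Finset.sum_comm
    have h2 : (∑ f ∈ C, (bad f : ℝ)) = ∑ p ∈ M, ((C.filter fun f => f p.1 = f p.2).card : ℝ) := by
      exact_mod_cast h1
    rw [h2]
    refine (Finset.sum_le_card_nsmul _ _ _ hM).trans (le_of_eq ?_)
    rw [nsmul_eq_mul, hμ]
    ring
  have hlower : Real.exp (-μ) * C.card ≤ ∑ f ∈ C, ∏ p ∈ M, w (f p.1, f p.2) := by
    have h1 : ∀ f ∈ C, Real.exp (-μ) * (1 + μ - bad f) ≤ ∏ p ∈ M, w (f p.1, f p.2) := by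
      intro f _
      rw [hprod, show -(bad f : ℝ) = -μ + (μ - bad f) by ring, Real.exp_add]
      gcongr
      linarith [Real.add_one_le_exp (μ - bad f)]
    refine le_trans ?_ (Finset.sum_le_sum h1)
    rw [← Finset.mul_sum]
    gcongr
    rw [Finset.sum_sub_distrib]
    simp only [Finset.sum_const, nsmul_eq_mul]
    linarith
  let Ψ : (X → Fin 2) → ({p // p ∈ M} → Fin 2 × Fin 2) × ({x // x ∈ S} → Fin 2) :=
    fun f => (fun p => (f p.1.1, f p.1.2), fun x => f x)
  have hΨ : Set.InjOn Ψ C := by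
    intro f hf g hg hfg
    funext x
    rcases hcover x with hx | hx | ⟨p, hp, hx⟩
    · rw [hR f hf x hx, hR g hg x hx]
    · exact congrFun (congrArg Prod.snd hfg) ⟨x, hx⟩
    · have h := congrFun (congrArg Prod.fst hfg) ⟨p, hp⟩
      rcases hx with rfl | rfl
      · exact congrArg Prod.fst h
      · exact congrArg Prod.snd h
  have hupper : ∑ f ∈ C, ∏ p ∈ M, w (f p.1, f p.2) ≤
      2 ^ S.card * (2 + 2 * Real.exp (-1)) ^ M.card := by
    have h1 : ∑ f ∈ C, ∏ p ∈ M, w (f p.1, f p.2) =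
        ∑ z ∈ C.image Ψ, ∏ p : {p // p ∈ M}, w (z.1 p) := by
      rw [Finset.sum_image hΨ]
      refine Finset.sum_congr rfl fun f _ => ?_
      exact (Finset.prod_coe_sort M fun p => w (f p.1, f p.2)).symm
    rw [h1]
    refine (Finset.sum_le_univ_sum_of_nonneg fun z => Finset.prod_nonneg fun p _ => hw _).trans
      (le_of_eq ?_)
    rw [Fintype.sum_prod_type]
    simp only [Finset.sum_const, nsmul_eq_mul]
    rw [← Finset.mul_sum]
    have h2 : ∑ z : {p // p ∈ M} → Fin 2 × Fin 2, ∏ p, w (z p) =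
        (2 + 2 * Real.exp (-1)) ^ M.card := by
      rw [← Fintype.piFinset_univ, ← Finset.prod_univ_sum]
      simp only [Fintype.sum_prod_type, Fin.sum_univ_two, w, Finset.prod_const]
      simp
      ring
    rw [h2]
    simp
  have h1 : (2 + 2 * Real.exp (-1)) ≤ 3 * Real.exp (-(1 / 50)) := by
    have h2 : Real.exp (-1) ≤ 0.37 := by
      rw [Real.exp_neg, inv_le_comm₀ (Real.exp_pos _) (by norm_num)]
      have := Real.exp_one_gt_d9
      norm_num at this ⊢
      linarith
    have h3 := Real.add_one_le_exp (-(1 / 50) : ℝ)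
    norm_num at h2 h3 ⊢
    linarith
  have h2 : Real.exp (-μ) * C.card ≤ Real.exp (-μ) * (2 ^ S.card * 3 ^ M.card) := by
    refine (hlower.trans hupper).trans ?_
    have h3 : Real.exp (-μ) = Real.exp (-(1 / 50)) ^ M.card := by
      rw [← Real.exp_nat_mul, hμ]; ring_nf
    have h4 := pow_le_pow_left₀ (by positivity) h1 M.card
    rw [mul_pow] at h4
    rw [h3]
    calc _ ≤ (2 : ℝ) ^ S.card * (3 ^ M.card * Real.exp (-(1 / 50)) ^ M.card) := by gcongr
      _ = _ := by ring
  exact le_of_mul_le_mul_left h2 (Real.exp_pos _)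

lemma two_mul_sq_lt_one_sub_rpow {ε : ℝ} (h0 : 0 < ε) (h1 : ε ≤ 1 / 2000) :
    2 * ε ^ 2 < 1 - (2 : ℝ) ^ (-ε) := by
  have h2 : (2 : ℝ) ^ (-ε) ≤ 1 + ε * (-(1 / 2)) := by
    have := rpow_one_add_le_one_add_mul_self (s := -(1 / 2)) (p := ε) (by norm_num) h0.le
      (by linarith)
    refine le_trans (le_of_eq ?_) this
    rw [Real.rpow_neg two_pos.le, ← Real.inv_rpow two_pos.le]
    norm_num
  nlinarith

lemma rpow_neg_mul_pow_le_sq {k : ℕ} (hk : 2 ≤ k) {ε ω : ℝ} (hε : ε = 1 / (500 * (k : ℝ) ^ 2))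
    (hω : ω = 4 * (k : ℝ) * Real.logb 2 (1 / ε) / ε) :
    0 < ε ∧ ε ≤ 1 / 2000 ∧ 0 ≤ ω ∧ 2 ^ (-(ε * ω)) * (ω + 2) ^ (k - 1) ≤ ε ^ 2 := by
  have hK : (2 : ℝ) ≤ k := by exact_mod_cast hk
  have hε0 : 0 < ε := by rw [hε]; positivity
  have hε1 : ε ≤ 1 / 2000 := by
    rw [hε]
    apply one_div_le_one_div_of_le (by norm_num)
    nlinarith
  have hinv : 1 / ε = 500 * (k : ℝ) ^ 2 := by rw [hε, one_div_one_div]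
  have hL0 : 0 ≤ Real.logb 2 (1 / ε) :=
    Real.logb_nonneg one_lt_two (by rw [hinv]; nlinarith)
  have hω0 : 0 ≤ ω := by rw [hω]; positivity
  refine ⟨hε0, hε1, hω0, ?_⟩
  have hL1 : Real.logb 2 (1 / ε) ≤ 9 + 2 * k := by
    rw [Real.logb_le_iff_le_rpow one_lt_two (by positivity), hinv]
    have h1 : (k : ℝ) ≤ 2 ^ k := by exact_mod_cast Nat.lt_two_pow_self.le
    have h2 : (2 : ℝ) ^ (9 + 2 * (k : ℝ)) = 2 ^ (9 + 2 * k) := by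
      rw [← Real.rpow_natCast]; push_cast; rfl
    rw [h2, pow_add, mul_comm 2 k, pow_mul]
    have h3 : (k : ℝ) ^ 2 ≤ (2 ^ k) ^ 2 := by gcongr
    nlinarith
  have hexp : (2 : ℝ) ^ (-(ε * ω)) = ε ^ (4 * k) := by
    have h1 : ε * ω = Real.logb 2 (1 / ε) * (4 * k : ℕ) := by
      rw [hω]; push_cast; field_simp
    rw [Real.rpow_neg two_pos.le, h1, Real.rpow_mul two_pos.le,
      Real.rpow_logb two_pos (by norm_num) (by positivity), Real.rpow_natCast]
    simp
  have hω2 : ω + 2 ≤ (1 / ε) ^ 2 := by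
    have h1 : ω = 4 * k * Real.logb 2 (1 / ε) * (1 / ε) := by rw [hω]; ring
    have h2 : 4 * k * Real.logb 2 (1 / ε) * (1 / ε) ≤ 4 * k * (9 + 2 * k) * (1 / ε) := by gcongr
    rw [h1]
    refine (add_le_add_left h2 2).trans ?_
    rw [hinv]
    nlinarith [mul_self_nonneg (k : ℝ), mul_nonneg (sq_nonneg (k : ℝ)) (sub_nonneg.2 hK),
      pow_le_pow_left₀ zero_le_two hK 4, pow_le_pow_left₀ zero_le_two hK 3,
      mul_le_mul_of_nonneg_left hK (pow_nonneg (zero_le_two.trans hK) 3)]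
  calc 2 ^ (-(ε * ω)) * (ω + 2) ^ (k - 1) ≤ ε ^ (4 * k) * ((1 / ε) ^ 2) ^ (k - 1) := by
        rw [hexp]; gcongr
    _ = ε ^ (2 * k + 2) := by
        obtain ⟨j, rfl⟩ : ∃ j, k = j + 1 := ⟨k - 1, by omega⟩
        rw [show 4 * (j + 1) = (2 * (j + 1) + 2) + 2 * j by ring, pow_add, add_tsub_cancel_right,
          ← pow_mul, mul_assoc, ← mul_pow, mul_one_div_cancel hε0.ne', one_pow, mul_one]
    _ ≤ ε ^ 2 := pow_le_pow_of_le_one hε0.le (by linarith) (by omega)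

open Classical in
/-- The elements are classified by a tag and a level: `0` for unpaired elements pinned to their
level, `2` for elements with several possible levels, `3` for matched pinned elements and `4`
for elements of prescribed colour. -/
lemma exists_tags {X : Type*} [Fintype X] [PartialOrder X] {C : Finset (X → Fin 2)}
    {ε ω : ℝ} {k : ℕ} (hk : 2 ≤ k) (hε : 0 ≤ ε) (hω : 0 ≤ ω) (hne : C.Nonempty)
    (hno : ∀ f ∈ C, ∀ c x, ¬ ColourChain (fun a b => a < b) f c (k - 1) x)
    (hq : 2 * (2 ^ (-(ε * ω)) * (ω + 2) ^ (k - 1)) < 1 - (2 : ℝ) ^ (-ε))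
    (hq' : 2 ^ (-(ε * ω)) * (ω + 2) ^ (k - 1) ≤ (1 : ℝ) / 200) :
    ∃ (t : X → Fin 5) (l : X → ℕ), (∀ x, 1 ≤ l x ∧ l x ≤ k - 1) ∧ (∀ x, t x ≠ 1) ∧
      (∀ x, t x = 2 → l x < k - 1) ∧
      ((C.card : ℝ) ≤ 2 ^ (((Finset.univ.filter fun x => t x = 0).card : ℝ) +
          (Finset.univ.filter fun x => t x = 2).card +
          ε * (Finset.univ.filter fun x => t x = 4).card) *
        3 ^ (((Finset.univ.filter fun x => t x = 3).card : ℝ) / 2)) ∧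
      (∀ x y, t x = 0 → t y = 0 → l x = l y → ¬ x < y) ∧
      (∀ x i, t x ≠ 0 → (l x = i ∨ t x = 2 ∧ l x + 1 = i) →
        ((Finset.univ.filter fun y => t y = 0 ∧ l y = i ∧ (y < x ∨ x < y)).card : ℝ) ≤ 2 * ω) ∧
      (∀ x, ((Finset.univ.filter fun y => t y ≠ 4 ∧ l y = l x ∧ y < x).card : ℝ) ≤ ω) := by
  obtain ⟨C₀, hC₀, hne₀, R, ρ, hsp, hcard⟩ := exists_isSpread C hne ε
  obtain ⟨lo, hi, h1, h2, h3, h4⟩ := exists_levels hk hsp hε hω hne₀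
    (fun f hf => hno f (hC₀ hf)) hq hq'
  obtain ⟨P, hPQ, M, hM1, hM2, hM3, hM4⟩ := exists_maximal_matching
    (fun x y : X => x < y ∧ lo x = lo y) (fun x h => lt_irrefl x h.1)
    (Finset.univ.filter fun x => x ∉ R ∧ lo x = hi x)
  have hP : ∀ x ∈ P, x ∉ R ∧ lo x = hi x := fun x hx => by simpa using hPQ hx
  obtain ⟨t, ht⟩ : ∃ t : X → Fin 5, ∀ x, t x =
      if x ∈ R then 4 else if lo x < hi x then 2 else if x ∈ P then 3 else 0 := ⟨_, fun _ => rfl⟩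
  have t0 : ∀ x, t x = 0 ↔ x ∉ R ∧ lo x = hi x ∧ x ∉ P := by
    intro x
    have := (h1 x).1
    rw [ht]
    split_ifs with ha hb hc <;> simp [*]
    · omega
    · omega
  have t2 : ∀ x, t x = 2 ↔ x ∉ R ∧ lo x < hi x := by
    intro x
    rw [ht]
    split_ifs with ha hb hc <;> simp [*]
  have t3 : ∀ x, t x = 3 ↔ x ∈ P := by
    intro x
    have := hP x
    rw [ht]
    split_ifs with ha hb hc <;> simp [*]
    · tauto
    · intro h; have := this h; omega
  have t4 : ∀ x, t x = 4 ↔ x ∈ R := by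
    intro x
    rw [ht]
    split_ifs with ha hb hc <;> simp [*]
  obtain ⟨l, hl⟩ : ∃ l : X → ℕ, ∀ x, l x = lo x + 1 := ⟨_, fun _ => rfl⟩
  refine ⟨t, l, ?_, ?_, ?_, ?_, ?_, ?_, ?_⟩
  · intro x
    have := h1 x
    have := hl x
    omega
  · intro x
    rw [ht]
    split_ifs <;> simp
  · intro x hx
    have := (t2 x).1 hx
    have := h1 x
    have := hl x
    omega
  · have h5 := card_le_two_pow_mul_three_pow (C := C₀) (R := R) (ρ := ρ)
      (S := (Finset.univ.filter fun x => t x = 0) ∪ Finset.univ.filter fun x => t x = 2) M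
      hsp.agree (fun x => ?_) (fun p hp => ?_)
    · rw [Finset.filter_congr fun x _ => t3 x, Finset.filter_congr fun x _ => t4 x,
        Finset.filter_univ_mem, Finset.filter_univ_mem]
      refine hcard.trans ?_
      rw [add_comm, Real.rpow_add two_pos, mul_assoc]
      gcongr
      refine h5.trans ?_
      gcongr
      · rw [← Real.rpow_natCast]
        refine Real.rpow_le_rpow_of_exponent_le one_le_two ?_
        exact_mod_cast Finset.card_union_le _ _
      · rw [← Real.rpow_natCast]
        refine Real.rpow_le_rpow_of_exponent_le (by norm_num) ?_
        rw [le_div_iff₀ two_pos, mul_comm]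
        exact_mod_cast hM2
    · by_cases hx : x ∈ P
      · exact Or.inr (Or.inr (hM3 x hx))
      · have := (h1 x).1.lt_or_eq
        simp only [Finset.mem_union, Finset.mem_filter, Finset.mem_univ, true_and, t0, t2]
        tauto
    · obtain ⟨ha, hb, hc⟩ := hM1 p hp
      exact h4 _ _ (hP _ ha).1 (hP _ hb).1 hc.1 (hP _ ha).2 (hP _ hb).2 hc.2
  · intro x y hx hy hxy hlt
    rw [t0] at hx hy
    rw [hl, hl] at hxy
    exact hM4 x (by simp [hx.1, hx.2.1]) y (by simp [hy.1, hy.2.1]) hx.2.2 hy.2.2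
      ⟨hlt, by omega⟩
  · intro x i hx hxi
    obtain ⟨j, rfl, h5, h6⟩ : ∃ j, i = j + 1 ∧ lo x ≤ j ∧ j ≤ hi x := by
      have := h1 x
      have := hl x
      rcases hxi with h | ⟨h, h'⟩
      · exact ⟨lo x, by omega, by omega, by omega⟩
      · have := (t2 x).1 h
        exact ⟨lo x + 1, by omega, by omega, by omega⟩
    refine le_trans (Nat.cast_le.2 (Finset.card_le_card fun y hy => ?_)) (h2 x j h5 h6)
    simp only [Finset.mem_filter, Finset.mem_univ, true_and, t0, hl] at hy ⊢
    exact ⟨hy.1.1, by omega, by omega, hy.2.2⟩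
  · intro x
    refine le_trans (Nat.cast_le.2 (Finset.card_le_card fun y hy => ?_)) (h3 x)
    simp only [Finset.mem_filter, Finset.mem_univ, true_and, t4, hl, ne_eq] at hy ⊢
    exact ⟨hy.1, by omega, hy.2.2⟩

lemma ColourChain.exists_strictMono {X : Type*} [PartialOrder X] {f : X → Fin 2} {c : Fin 2}
    {i : ℕ} : ∀ {x : X}, ColourChain (fun a b => a < b) f c i x →
      ∃ ch : Fin (i + 1) → X, StrictMono ch ∧ (∀ j, f (ch j) = c) ∧ ch (Fin.last i) = x := by
  induction i with
  | zero =>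
    intro x h
    exact ⟨fun _ => x, fun a b h => by omega, fun _ => h, rfl⟩
  | succ i ih =>
    rintro x ⟨hx, y, hyx, hy⟩
    obtain ⟨ch, h1, h2, h3⟩ := ih hy
    refine ⟨Fin.snoc (α := fun _ => X) ch x, Fin.strictMono_iff_lt_succ.2 fun j => ?_,
      fun j => ?_, by simp⟩
    · induction j using Fin.lastCases with
      | last => simpa [h3] using hyx
      | cast j =>
        rw [Fin.succ_castSucc, Fin.snoc_castSucc, Fin.snoc_castSucc]
        exact h1 j.castSucc_lt_succ
    · induction j using Fin.lastCases with
      | last => simpa using hx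
      | cast j => simpa using h2 j

lemma IsRKColouring.not_colourChain {n k : ℕ} (hk : 2 ≤ k) {F : Finset (Finset (Fin n))}
    {f : {A // A ∈ F} → Fin 2} (hf : IsRKColouring k F f) (c : Fin 2) (x : {A // A ∈ F}) :
    ¬ ColourChain (fun a b => a < b) f c (k - 1) x := by
  intro h
  obtain ⟨ch, h1, h2, -⟩ := h.exists_strictMono
  obtain ⟨m, rfl⟩ : ∃ m, k = m + 1 := ⟨k - 1, by omega⟩
  obtain ⟨i, j, hij⟩ := hf ch fun i j hij => h1 hij
  exact hij ((h2 i).trans (h2 j).symm)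

/-- A poset with a 2-colouring without long monochromatic chains is covered by few antichains. -/
lemma exists_label_ne_of_lt {X : Type*} [PartialOrder X] {k : ℕ} (hk : 2 ≤ k) {f : X → Fin 2}
    (hf : ∀ c x, ¬ ColourChain (fun a b => a < b) f c (k - 1) x) :
    ∃ g : X → ℕ, (∀ x, g x < 2 * k - 2) ∧ ∀ x y, x < y → g x ≠ g y := by
  classical
  let h (x : X) : ℕ := Nat.findGreatest (fun i => ColourChain (fun a b => a < b) f (f x) i x) (k - 2)
  have h1 : ∀ x, ColourChain (fun a b => a < b) f (f x) (h x) x := fun x =>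
    Nat.findGreatest_spec (P := fun i => ColourChain (fun a b => a < b) f (f x) i x)
      (Nat.zero_le _) rfl
  have h2 : ∀ x, h x ≤ k - 2 := fun x => Nat.findGreatest_le _
  refine ⟨fun x => 2 * h x + f x, fun x => ?_, fun x y hxy heq => ?_⟩
  · have := h2 x
    have := (f x).2
    dsimp only
    omega
  · have h3 : f x = f y := by dsimp only at heq; omega
    have h4 : ColourChain (fun a b => a < b) f (f y) (h x + 1) y :=
      ⟨rfl, x, hxy, h3 ▸ h1 x⟩
    have h5 : h x ≠ k - 2 := fun h => hf _ y (by rwa [h, show k - 2 + 1 = k - 1 by omega] at h4)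
    have h6 : h x + 1 ≤ h y := Nat.le_findGreatest (by have := h2 x; omega) h4
    dsimp only at heq
    omega

lemma exists_large_antichain {n k : ℕ} (hk : 2 ≤ k) {F : Finset (Finset (Fin n))}
    {f : {A // A ∈ F} → Fin 2} (hf : IsRKColouring k F f) (H : Finset (Finset (Fin n)))
    (hH : H ⊆ F) : ∃ H' ⊆ H, IsAntichain (· ⊆ ·) (H' : Set (Finset (Fin n))) ∧
      (H.card : ℝ) / (2 * (k : ℝ) - 2) ≤ (H'.card : ℝ) := by
  obtain ⟨g, hg, hg'⟩ := exists_label_ne_of_lt hk (hf.not_colourChain hk)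
  let G (S : Finset (Fin n)) : ℕ := if h : S ∈ F then g ⟨S, h⟩ else 0
  have hG : ∀ S (h : S ∈ F), G S = g ⟨S, h⟩ := fun S h => dif_pos h
  have hpos : (0 : ℝ) < 2 * k - 2 := by
    have : (2 : ℝ) ≤ k := by exact_mod_cast hk
    linarith
  obtain ⟨b, -, hb⟩ := Finset.exists_le_card_fiber_of_nsmul_le_card_of_maps_to
    (s := H) (t := Finset.range (2 * k - 2)) (f := G) (b := (H.card : ℝ) / (2 * (k : ℝ) - 2))
    (fun S hS => by rw [hG S (hH hS), Finset.mem_range]; exact hg _)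
    (Finset.nonempty_range_iff.2 (by omega))
    (by
      rw [Finset.card_range, nsmul_eq_mul, Nat.cast_sub (by omega)]
      push_cast
      rw [mul_div_cancel₀ _ hpos.ne'])
  refine ⟨_, Finset.filter_subset _ _, fun S hS T hT hne hle => ?_, hb⟩
  rw [Finset.mem_coe, Finset.mem_filter] at hS hT
  refine hg' ⟨S, hH hS.1⟩ ⟨T, hH hT.1⟩ (lt_of_le_of_ne hle fun h => hne (congrArg Subtype.val h)) ?_
  rw [← hG, ← hG, hS.2, hT.2]

lemma card_univ_filter_coe {α : Type*} (F : Finset α) (p : α → Prop) [DecidablePred p]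
    {q : {a // a ∈ F} → Prop} {_ : DecidablePred q} (h : ∀ x, q x ↔ p x) :
    (Finset.univ.filter q).card = (F.filter p).card := by
  rw [Finset.filter_congr fun x _ => h x]
  refine Finset.card_bij (fun x _ => x.1) (fun x hx => by simpa using hx)
    (fun _ _ _ _ h => Subtype.ext h) fun a ha => ?_
  obtain ⟨h1, h2⟩ := Finset.mem_filter.1 ha
  exact ⟨⟨a, h1⟩, by simpa using h2, rfl⟩

/-- Each comparable pair of `A ∪ B` is counted at a member of `B`. -/
lemma cpairs_union_le {n : ℕ} {A B : Finset (Finset (Fin n))} {ω : ℝ}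
    (hA : ∀ S ∈ A, ∀ T ∈ A, ¬ S ⊂ T)
    (h1 : ∀ S ∈ B, ((A.filter fun T => S ⊂ T ∨ T ⊂ S).card : ℝ) ≤ 2 * ω)
    (h2 : ∀ S ∈ B, ((B.filter fun T => T ⊂ S).card : ℝ) ≤ ω) :
    (cpairs (A ∪ B) : ℝ) ≤ 3 * ω * B.card := by
  have hsub : (((A ∪ B) ×ˢ (A ∪ B)).filter fun p => p.1 ⊂ p.2) ⊆ B.biUnion fun S =>
      ((A.filter fun T => S ⊂ T).image fun T => (S, T)) ∪
        ((A.filter fun T => T ⊂ S).image fun T => (T, S)) ∪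
          (B.filter fun T => T ⊂ S).image fun T => (T, S) := by
    rintro ⟨S, T⟩ h
    simp only [Finset.mem_filter, Finset.mem_product, Finset.mem_union] at h
    simp only [Finset.mem_biUnion, Finset.mem_union, Finset.mem_image, Finset.mem_filter,
      Prod.mk.injEq]
    obtain ⟨⟨hS | hS, hT | hT⟩, hST⟩ := h
    · exact absurd hST (hA S hS T hT)
    · exact ⟨T, hT, Or.inl (Or.inr ⟨S, ⟨hS, hST⟩, rfl, rfl⟩)⟩
    · exact ⟨S, hS, Or.inl (Or.inl ⟨T, ⟨hT, hST⟩, rfl, rfl⟩)⟩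
    · exact ⟨T, hT, Or.inr ⟨S, ⟨hS, hST⟩, rfl, rfl⟩⟩
  have h3 : ∀ S ∈ B, (((((A.filter fun T => S ⊂ T).image fun T => (S, T)) ∪
        ((A.filter fun T => T ⊂ S).image fun T => (T, S)) ∪
          (B.filter fun T => T ⊂ S).image fun T => (T, S)).card : ℕ) : ℝ) ≤ 3 * ω := by
    intro S hS
    have h4 := h1 S hS
    rw [Finset.filter_or, Finset.card_union_of_disjoint] at h4
    · refine (Nat.cast_le.2 ((Finset.card_union_le _ _).trans
        (add_le_add ((Finset.card_union_le _ _).trans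
          (add_le_add Finset.card_image_le Finset.card_image_le)) Finset.card_image_le))).trans ?_
      push_cast at h4 ⊢
      linarith [h2 S hS]
    · exact Finset.disjoint_filter.2 fun T _ h h' => ssubset_asymm h h'
  unfold cpairs
  refine (Nat.cast_le.2 ((Finset.card_le_card hsub).trans Finset.card_biUnion_le)).trans ?_
  push_cast
  refine (Finset.sum_le_card_nsmul _ _ _ h3).trans (le_of_eq ?_)
  rw [nsmul_eq_mul, mul_comm]

/-- The classification of the members of a colourable family by tags and levels. -/
lemma exists_tags_of_isRKColouring {n k : ℕ} (hk : 2 ≤ k) {ε ω : ℝ}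
    (hε : ε = 1 / (500 * (k : ℝ) ^ 2))
    (hω : ω = 4 * (k : ℝ) * Real.logb 2 (1 / ε) / ε) (F : Finset (Finset (Fin n)))
    (hcol : ∃ c : {A // A ∈ F} → Fin 2, IsRKColouring k F c) :
    ∃ (t : Finset (Fin n) → Fin 5) (l : Finset (Fin n) → ℕ),
      (∀ S ∈ F, 1 ≤ l S ∧ l S ≤ k - 1) ∧ (∀ S ∈ F, t S ≠ 1) ∧
      (∀ S ∈ F, t S = 2 → l S < k - 1) ∧
      ((numColourings 2 k n F : ℝ) ≤ 2 ^ (((F.filter fun S => t S = 0).card : ℝ) +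
          (F.filter fun S => t S = 2).card + ε * (F.filter fun S => t S = 4).card) *
        3 ^ (((F.filter fun S => t S = 3).card : ℝ) / 2)) ∧
      (∀ S ∈ F, ∀ T ∈ F, t S = 0 → t T = 0 → l S = l T → ¬ S ⊂ T) ∧
      (∀ S ∈ F, ∀ i, t S ≠ 0 → (l S = i ∨ t S = 2 ∧ l S + 1 = i) →
        ((F.filter fun T => (t T = 0 ∧ l T = i) ∧ (S ⊂ T ∨ T ⊂ S)).card : ℝ) ≤ 2 * ω) ∧
      (∀ S ∈ F, ((F.filter fun T => (t T ≠ 4 ∧ l T = l S) ∧ T ⊂ S).card : ℝ) ≤ ω) := by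
  classical
  obtain ⟨hε0, hε1, hω0, hnum⟩ := rpow_neg_mul_pow_le_sq hk hε hω
  have hC : ∀ f, f ∈ Finset.univ.filter (fun f : {A // A ∈ F} → Fin 2 => IsRKColouring k F f) ↔
      IsRKColouring k F f := by simp
  obtain ⟨t, l, h1, h2, h3, h4, h5, h6, h7⟩ := exists_tags hk hε0.le hω0
    (by obtain ⟨c, hc⟩ := hcol; exact ⟨c, (hC c).2 hc⟩)
    (fun f hf => ((hC f).1 hf).not_colourChain hk)
    (by linarith [two_mul_sq_lt_one_sub_rpow hε0 hε1]) (by nlinarith)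
  obtain ⟨t', ht⟩ : ∃ t' : Finset (Fin n) → Fin 5, ∀ x : {A // A ∈ F}, t' x = t x :=
    ⟨fun S => if h : S ∈ F then t ⟨S, h⟩ else 0, fun x => dif_pos x.2⟩
  obtain ⟨l', hl⟩ : ∃ l' : Finset (Fin n) → ℕ, ∀ x : {A // A ∈ F}, l' x = l x :=
    ⟨fun S => if h : S ∈ F then l ⟨S, h⟩ else 0, fun x => dif_pos x.2⟩
  refine ⟨t', l', ?_, ?_, ?_, ?_, ?_, ?_, ?_⟩
  · intro S hS
    rw [hl ⟨S, hS⟩]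
    exact h1 _
  · intro S hS
    rw [ht ⟨S, hS⟩]
    exact h2 _
  · intro S hS
    rw [ht ⟨S, hS⟩, hl ⟨S, hS⟩]
    exact h3 _
  · have hcount : ∀ a, (Finset.univ.filter fun x => t x = a).card =
        (F.filter fun S => t' S = a).card := fun a =>
      card_univ_filter_coe F _ fun x => by rw [ht]
    rw [numColourings, Nat.card_eq_fintype_card, Fintype.card_subtype]
    simpa only [hcount] using h4
  · intro S hS T hT
    rw [ht ⟨S, hS⟩, ht ⟨T, hT⟩, hl ⟨S, hS⟩, hl ⟨T, hT⟩]
    exact h5 _ _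
  · intro S hS i
    rw [ht ⟨S, hS⟩, hl ⟨S, hS⟩]
    intro h8 h9
    refine le_trans (le_of_eq (congrArg _ (Eq.symm ?_))) (h6 ⟨S, hS⟩ i h8 h9)
    refine card_univ_filter_coe F _ fun x => ?_
    rw [ht, hl, and_assoc, or_comm]
    rfl
  · intro S hS
    rw [hl ⟨S, hS⟩]
    refine le_trans (le_of_eq (congrArg _ (Eq.symm ?_))) (h7 ⟨S, hS⟩)
    refine card_univ_filter_coe F _ fun x => ?_
    rw [ht, hl, and_assoc]
    rfl

/-- The partition proposition: if `𝓕 ⊆ 2^[n]` admits a `(2,k)`-colouring,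
then it can be partitioned into families `𝓐ᵢ, 𝓤ᵢ, 𝓓ᵢ, 𝓟ᵢ, 𝓡ᵢ` (`i ∈ {1,…,k-1}`) satisfying
(P1)–(P5).  Here `Fam 0 = 𝓐`, `Fam 1 = 𝓤`, `Fam 2 = 𝓓`, `Fam 3 = 𝓟`, `Fam 4 = 𝓡`, with
`Fam a i = ∅` for indices `i ∉ {1,…,k-1}` (which encodes the conventions
`𝓤_k = 𝓓₀ = ∅`). -/
theorem kchain_partition (k n : ℕ) (hk : 2 ≤ k) (hn : 0 < n)
    (ε ω : ℝ) (hε : ε = 1 / (500 * (k : ℝ) ^ 2))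
    (hω : ω = 4 * (k : ℝ) * Real.logb 2 (1 / ε) / ε)
    (F : Finset (Finset (Fin n)))
    (hcol : ∃ c : {A // A ∈ F} → Fin 2, IsRKColouring k F c) :
    ∃ Fam : Fin 5 → ℕ → Finset (Finset (Fin n)),
      -- the `Fam a i` form a partition of `F` into pairwise disjoint subfamilies
      (∀ a i, Fam a i ⊆ F) ∧
      (∀ a b : Fin 5, ∀ i j : ℕ, (a, i) ≠ (b, j) → Disjoint (Fam a i) (Fam b j)) ∧
      (∀ S ∈ F, ∃ a i, S ∈ Fam a i) ∧
      (∀ a : Fin 5, ∀ i ∉ Finset.Icc 1 (k - 1), Fam a i = ∅) ∧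
      -- (P1)
      ((numColourings 2 k n F : ℝ) ≤
        2 ^ (((((Finset.Icc 1 (k - 1)).biUnion (Fam 0)).card
              + ((Finset.Icc 1 (k - 1)).biUnion (Fam 1)).card
              + ((Finset.Icc 1 (k - 1)).biUnion (Fam 2)).card : ℕ) : ℝ)
            + ε * (((Finset.Icc 1 (k - 1)).biUnion (Fam 4)).card : ℝ))
          * 3 ^ ((((Finset.Icc 1 (k - 1)).biUnion (Fam 3)).card : ℝ) / 2)) ∧
      -- (P2)
      (∀ i : ℕ, IsAntichain (· ⊆ ·) ((Fam 0 i : Set (Finset (Fin n))))) ∧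
      -- (P3)
      (Fam 1 1 = ∅ ∧ Fam 2 (k - 1) = ∅ ∧
        ∀ i ∈ Finset.Icc 1 (k - 1), ∀ S : Finset (Fin n),
          (S ∈ Fam 1 i ∨ S ∈ Fam 1 (i + 1) ∨ S ∈ Fam 2 i ∨ S ∈ Fam 2 (i - 1) ∨
            S ∈ Fam 3 i ∨ S ∈ Fam 4 i) →
          ((((Fam 0 i).filter fun T => S ⊂ T ∨ T ⊂ S).card : ℝ) ≤ 2 * ω)) ∧
      -- (P4)
      (∀ i ∈ Finset.Icc 1 (k - 1), ∀ B : Finset (Finset (Fin n)),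
        (B = Fam 1 i ∪ Fam 2 i ∪ Fam 3 i ∨ B = Fam 1 i ∪ Fam 2 (i - 1) ∨
          B = Fam 2 i ∪ Fam 1 (i + 1)) →
        (cpairs (Fam 0 i ∪ B) : ℝ) ≤ 3 * ω * (B.card : ℝ)) ∧
      -- (P5)
      (∀ H ⊆ F, ∃ H' ⊆ H, IsAntichain (· ⊆ ·) (H' : Set (Finset (Fin n))) ∧
        (H.card : ℝ) / (2 * (k : ℝ) - 2) ≤ (H'.card : ℝ)) := by
 
  obtain ⟨t, l, h1, h2, h3, h4, h5, h6, h7⟩ := exists_tags_of_isRKColouring hk hε hω F hcol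
  obtain ⟨Fam, hFam⟩ : ∃ Fam : Fin 5 → ℕ → Finset (Finset (Fin n)),
      ∀ a i, Fam a i = F.filter fun S => t S = a ∧ l S = i := ⟨_, fun _ _ => rfl⟩
  have hmem : ∀ {a i S}, S ∈ Fam a i ↔ S ∈ F ∧ t S = a ∧ l S = i := fun {a i S} => by
    rw [hFam, Finset.mem_filter]
  have hunion : ∀ a, (Finset.Icc 1 (k - 1)).biUnion (Fam a) = F.filter fun S => t S = a := by
    intro a
    ext S
    simp only [Finset.mem_biUnion, hmem, Finset.mem_Icc, Finset.mem_filter]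
    constructor
    · rintro ⟨i, -, h, h', -⟩
      exact ⟨h, h'⟩
    · rintro ⟨h, h'⟩
      exact ⟨l S, h1 S h, h, h', rfl⟩
  have hU : ∀ i, Fam 1 i = ∅ := fun i =>
    Finset.eq_empty_of_forall_notMem fun S hS => h2 S (hmem.1 hS).1 (hmem.1 hS).2.1
  have hcomp : ∀ i S, S ∈ F → t S ≠ 0 → (l S = i ∨ t S = 2 ∧ l S + 1 = i) →
      (((Fam 0 i).filter fun T => S ⊂ T ∨ T ⊂ S).card : ℝ) ≤ 2 * ω := by
    intro i S hS h8 h9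
    rw [hFam, Finset.filter_filter]
    exact h6 S hS i h8 h9
  refine ⟨Fam, fun a i S hS => (hmem.1 hS).1, ?_, fun S hS => ⟨t S, l S, hmem.2 ⟨hS, rfl, rfl⟩⟩,
    ?_, ?_, ?_, ⟨hU 1, ?_, ?_⟩, ?_, ?_⟩
  · intro a b i j hne
    refine Finset.disjoint_left.2 fun S hS hS' => hne ?_
    rw [← (hmem.1 hS).2.1, ← (hmem.1 hS).2.2, ← (hmem.1 hS').2.1, ← (hmem.1 hS').2.2]
  · refine fun a i hi => Finset.eq_empty_of_forall_notMem fun S hS => hi ?_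
    rw [Finset.mem_Icc, ← (hmem.1 hS).2.2]
    exact h1 S (hmem.1 hS).1
  · have : (Finset.Icc 1 (k - 1)).biUnion (Fam 1) = ∅ := by
      rw [hunion]
      exact Finset.filter_false_of_mem h2
    rw [this, hunion, hunion, hunion, hunion, Finset.card_empty, add_zero, Nat.cast_add]
    exact h4
  · intro i S hS T hT hne hle
    obtain ⟨hS, h8, h9⟩ := hmem.1 hS
    obtain ⟨hT, h10, h11⟩ := hmem.1 hT
    exact h5 S hS T hT h8 h10 (h9.trans h11.symm) (hle.ssubset_of_ne hne)
  · refine Finset.eq_empty_of_forall_notMem fun S hS => ?_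
    obtain ⟨hS, h8, h9⟩ := hmem.1 hS
    exact (h3 S hS h8).ne h9
  · intro i hi S hS
    rw [Finset.mem_Icc] at hi
    simp only [hU, Finset.notMem_empty, false_or, hmem] at hS
    rcases hS with h | h | h | h <;> obtain ⟨h, h8, h9⟩ := h <;>
      refine hcomp i S h (by rw [h8]; decide) ?_
    · exact Or.inl h9
    · exact Or.inr ⟨h8, by omega⟩
    · exact Or.inl h9
    · exact Or.inl h9
  · intro i hi B hB
    rw [Finset.mem_Icc] at hi
    obtain ⟨j, hj⟩ : ∃ j, ∀ S ∈ B, S ∈ F ∧ t S ≠ 0 ∧ t S ≠ 4 ∧ l S = j ∧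
        (l S = i ∨ t S = 2 ∧ l S + 1 = i) := by
      simp only [hU, Finset.empty_union, Finset.union_empty] at hB
      rcases hB with rfl | rfl | rfl
      · refine ⟨i, fun S hS => ?_⟩
        rcases Finset.mem_union.1 hS with h | h <;> obtain ⟨h, h8, h9⟩ := hmem.1 h <;>
          simp [h, h8, h9]
      · refine ⟨i - 1, fun S hS => ?_⟩
        obtain ⟨h, h8, h9⟩ := hmem.1 hS
        refine ⟨h, by rw [h8]; decide, by rw [h8]; decide, h9, Or.inr ⟨h8, by omega⟩⟩
      · refine ⟨i, fun S hS => ?_⟩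
        obtain ⟨h, h8, h9⟩ := hmem.1 hS
        simp [h, h8, h9]
    refine cpairs_union_le (fun S hS T hT => ?_) (fun S hS => ?_) fun S hS => ?_
    · obtain ⟨hS, h8, h9⟩ := hmem.1 hS
      obtain ⟨hT, h10, h11⟩ := hmem.1 hT
      exact h5 S hS T hT h8 h10 (h9.trans h11.symm)
    · obtain ⟨h, h8, -, -, h9⟩ := hj S hS
      exact hcomp i S h h8 h9
    · obtain ⟨h, -, -, h8, -⟩ := hj S hS
      refine le_trans (Nat.cast_le.2 (Finset.card_le_card fun T hT => ?_)) (h7 S h)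
      obtain ⟨hT, hTS⟩ := Finset.mem_filter.1 hT
      obtain ⟨h9, -, h10, h11, -⟩ := hj T hT
      exact Finset.mem_filter.2 ⟨h9, ⟨h10, h11.trans h8.symm⟩, hTS⟩
  · obtain ⟨c, hc⟩ := hcol
    exact exists_large_antichain hk hc
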